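/- There exist constants C > 0 and β₀ > 0 such that for all β ≥ β₀ and each choice of sign, |(1/2)·M(r_β^±) − (β − 1/2 ± 1/2 + 1/(2π²β))| ≤ C/β². -/

import Mathlib

open Filter MeasureTheory Real Complex

/-- The Beurling function `H₀(x) = (sin πx/π)² {Σ_{m∈ℤ} sgn(m)/(x−m)² + 2/x}`. -/
noncomputable def H0 (x : ℝ) : ℝ :=
  (Real.sin (π * x) / π) ^ 2 * ((∑' m : ℤ, (Int.sign m : ℝ) / (x - m) ^ 2) + 2 / x)

/-- `H₁(x) = (sin πx/(πx))²`. -/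
noncomputable def H1 (x : ℝ) : ℝ := (Real.sin (π * x) / (π * x)) ^ 2

/-- Beurling's majorant `H⁺ = H₀ + H₁` of `sgn`. -/
noncomputable def Hplus (x : ℝ) : ℝ := H0 x + H1 x

/-- Beurling's minorant `H⁻ = H₀ − H₁` of `sgn`. -/
noncomputable def Hminus (x : ℝ) : ℝ := H0 x - H1 x

/-- The Beurling–Selberg majorant `r_β⁺(x) = ½{H⁺(x+β) + H⁺(−x+β)}` of `χ_{[−β,β]}`. -/
noncomputable def rPlus (β : ℝ) (x : ℝ) : ℝ := (Hplus (x + β) + Hplus (-x + β)) / 2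

/-- The Beurling–Selberg minorant `r_β⁻(x) = ½{H⁻(x+β) + H⁻(−x+β)}` of `χ_{[−β,β]}`. -/
noncomputable def rMinus (β : ℝ) (x : ℝ) : ℝ := (Hminus (x + β) + Hminus (-x + β)) / 2

/-- The pair correlation density `1 - (sin πx / (πx))²`. -/
noncomputable def pairCorKernel (x : ℝ) : ℝ := 1 - (Real.sin (π * x) / (π * x)) ^ 2

/-- `M(R) = ∫ R(x) {1 - (sin πx/(πx))²} dx`. -/
noncomputable def Mpc (R : ℝ → ℝ) : ℝ := ∫ x : ℝ, R x * pairCorKernel x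


lemma fc (x : ℝ) (n : ℤ) (hx : x - n ≠ 0) :
    fourierCoeffOn (show (-(1/2:ℝ)) < 1/2 by norm_num)
      (fun t : ℝ => Complex.exp (2 * π * I * x * t)) n
      = ((Real.sin (π * (x - n)) / (π * (x - n)) : ℝ) : ℂ) := by
  rw [fourierCoeffOn_eq_integral]
  have hc : (2 * π * I * (x - n) : ℂ) ≠ 0 := by
    have : ((x - n : ℝ) : ℂ) ≠ 0 := by exact_mod_cast hx
    push_cast at this
    simp [Real.pi_ne_zero, this]
  have h : ∀ t : ℝ, (fourier (-n) (t : AddCircle ((1/2:ℝ) - -(1/2))) : ℂ) •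
      Complex.exp (2 * π * I * x * t) = Complex.exp ((2 * π * I * (x - n)) * t) := by
    intro t
    rw [fourier_coe_apply, smul_eq_mul, ← Complex.exp_add]
    congr 1
    push_cast
    ring
  simp_rw [h]
  rw [integral_exp_mul_complex hc]
  push_cast
  rw [Complex.sin]
  have hx' : (x - n : ℂ) ≠ 0 := by exact_mod_cast hx
  have hpi : (π : ℂ) ≠ 0 := by exact_mod_cast Real.pi_ne_zero
  have e1 : (2 * π * I * (x - n) * (1/2) : ℂ) = π * (x - n) * I := by ring
  have e2 : (2 * π * I * (x - n) * (-(1/2)) : ℂ) = -(π * (x - n)) * I := by ring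
  rw [e1, e2]
  norm_num
  field_simp
  rw [I_sq]
  ring

lemma hasSum_H1 (x : ℝ) (hx : ∀ n : ℤ, x ≠ n) : HasSum (fun n : ℤ => H1 (x - n)) 1 := by
  have h := hasSum_sq_fourierCoeffOn (show (-(1/2:ℝ)) < 1/2 by norm_num)
    (f := fun t : ℝ => Complex.exp (2 * π * I * x * t)) (by
      refine MemLp.of_bound (C := 1) ?_ ?_
      · exact (by fun_prop : Continuous _).aestronglyMeasurable
      · refine ae_of_all _ fun t => ?_
        rw [show (2 * π * I * x * t : ℂ) = ((2 * π * x * t : ℝ) : ℂ) * I by push_cast; ring,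
          Complex.norm_exp_ofReal_mul_I])
  convert h using 1
  · funext n
    rw [fc x n (sub_ne_zero.2 (hx n)), Complex.norm_real, Real.norm_eq_abs, sq_abs, H1]
  · have : ∀ t : ℝ, ‖Complex.exp (2 * π * I * x * t)‖ = 1 := fun t => by
      rw [show (2 * π * I * x * t : ℂ) = ((2 * π * x * t : ℝ) : ℂ) * I by push_cast; ring,
          Complex.norm_exp_ofReal_mul_I]
    simp_rw [this]
    norm_num

lemma H1_nonneg (x : ℝ) : 0 ≤ H1 x := sq_nonneg _

lemma H1_neg (x : ℝ) : H1 (-x) = H1 x := by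
  unfold H1
  rw [mul_neg, Real.sin_neg, neg_div_neg_eq]

lemma H1_le_one (x : ℝ) : H1 x ≤ 1 := by
  unfold H1
  rw [sq_le_one_iff_abs_le_one, abs_div]
  exact div_le_one_of_le₀ Real.abs_sin_le_abs (abs_nonneg _)

lemma H1_le (x : ℝ) : x ^ 2 * H1 x ≤ 1 / π ^ 2 := by
  unfold H1
  rcases eq_or_ne x 0 with rfl | hx
  · simp; positivity
  · have := Real.pi_pos
    rw [div_pow, mul_pow]
    rw [show x ^ 2 * (Real.sin (π * x) ^ 2 / (π ^ 2 * x ^ 2)) = Real.sin (π * x) ^ 2 / π ^ 2 by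
      field_simp]
    gcongr
    exact Real.sin_sq_le_one _

lemma H1_meas : Measurable H1 := by
  unfold H1; fun_prop

lemma H1_int : Integrable H1 := by
  refine Integrable.mono' (integrable_inv_one_add_sq.const_mul 2) H1_meas.aestronglyMeasurable
    (ae_of_all _ fun x => ?_)
  rw [Real.norm_of_nonneg (H1_nonneg x), ← div_eq_mul_inv, le_div_iff₀ (by positivity)]
  have h1 := H1_le_one x
  have h2 := H1_le x
  have : 1 / π ^ 2 ≤ 1 := by
    rw [div_le_one (by positivity)]
    nlinarith [Real.pi_gt_three]
  nlinarith

lemma ae_nonint : ∀ᵐ x : ℝ, ∀ n : ℤ, x ≠ n := by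
  rw [ae_all_iff]
  intro n
  exact (measure_singleton (n : ℝ) : volume {(n : ℝ)} = 0) |> fun h => by
    rw [ae_iff]; simpa using h

lemma H1_integral : ∫ x, H1 x = 1 := by
  have h := H1_int.hasSum_intervalIntegral_comp_add_int
  have hi : ∀ n : ℤ, Integrable (fun x => H1 (x + n)) (volume.restrict (Set.Ioc (0:ℝ) 1)) :=
    fun n => (H1_int.comp_add_right (n : ℝ)).restrict
  simp_rw [intervalIntegral.integral_of_le zero_le_one] at h
  have h2 := hasSum_integral_of_summable_integral_norm hi (by
    refine h.summable.congr fun n => ?_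
    simp [Real.norm_of_nonneg (H1_nonneg _)])
  rw [h.unique h2]
  rw [integral_congr_ae (g := fun _ => (1:ℝ))]
  · simp
  · refine ae_restrict_of_ae ?_
    filter_upwards [ae_nonint] with x hx
    have := (hasSum_H1 x hx)
    rw [← (Equiv.neg ℤ).hasSum_iff] at this
    rw [← this.tsum_eq]
    simp [Function.comp_def]

lemma tele (y : ℝ) (hy : 0 < y) :
    HasSum (fun n : ℕ => 1 / (y + n) - 1 / (y + n + 1)) (1 / y) := by
  have hs : ∀ N : ℕ, ∑ n ∈ Finset.range N, (1 / (y + n) - 1 / (y + n + 1)) = 1 / y - 1 / (y + N) := by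
    intro N
    induction N with
    | zero => simp
    | succ k ih => rw [Finset.sum_range_succ, ih]; push_cast; ring
  rw [hasSum_iff_tendsto_nat_of_nonneg]
  · simp_rw [hs]
    have : Tendsto (fun N : ℕ => 1 / (y + N)) atTop (nhds 0) := by
      simp_rw [one_div]
      exact (tendsto_atTop_add_const_left _ y tendsto_natCast_atTop_atTop).inv_tendsto_atTop
    simpa using this.const_sub (1 / y)
  · intro n
    rw [sub_nonneg]
    apply one_div_le_one_div_of_le <;> linarith [(Nat.cast_nonneg n : (0:ℝ) ≤ n)]

lemma summ_sq (x : ℝ) (hx : ∀ n : ℤ, x ≠ n) : Summable (fun n : ℤ => 1 / (x - n) ^ 2) ∧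
    (Real.sin (π * x) / π) ^ 2 * ∑' n : ℤ, 1 / (x - n) ^ 2 = 1 := by
  have h := hasSum_H1 x hx
  have hs : Real.sin (π * x) ≠ 0 := by
    intro h0
    rw [Real.sin_eq_zero_iff] at h0
    obtain ⟨n, hn⟩ := h0
    refine hx n ?_
    have := Real.pi_pos
    nlinarith [mul_left_cancel₀ Real.pi_ne_zero (by linarith : π * (n:ℝ) = π * x)]
  have he : ∀ n : ℤ, H1 (x - n) = (Real.sin (π * x) / π) ^ 2 * (1 / (x - n) ^ 2) := by
    intro n
    unfold H1
    have h1 : Real.sin (π * (x - n)) ^ 2 = Real.sin (π * x) ^ 2 := by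
      rw [mul_sub, mul_comm π (n : ℝ), Real.sin_sub_int_mul_pi, mul_pow]
      rw [← zpow_natCast, ← zpow_mul, mul_comm n, zpow_mul]
      simp
    rw [div_pow, h1, mul_pow, div_pow]
    field_simp
  have hpi := Real.pi_ne_zero
  have hc : (Real.sin (π * x) / π) ^ 2 ≠ 0 := by positivity
  simp_rw [he] at h
  constructor
  · exact (summable_mul_left_iff hc).1 h.summable
  · rw [← tsum_mul_left, h.tsum_eq]

lemma H0_neg (x : ℝ) : H0 (-x) = - H0 x := by
  unfold H0
  have : ∑' m : ℤ, (Int.sign m : ℝ) / (-x - m) ^ 2 = - ∑' m : ℤ, (Int.sign m : ℝ) / (x - m) ^ 2 := by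
    rw [← (Equiv.neg ℤ).tsum_eq, ← tsum_neg]
    congr 1; funext m
    simp only [Equiv.neg_apply, Int.sign_neg]
    push_cast
    rw [show (-x - -(m:ℝ)) ^ 2 = (x - m) ^ 2 by ring]
    ring
  rw [this, mul_neg, Real.sin_neg]
  ring

lemma summ_sign (x : ℝ) (hx : ∀ n : ℤ, x ≠ n) :
    Summable (fun m : ℤ => (Int.sign m : ℝ) / (x - m) ^ 2) := by
  refine Summable.of_norm_bounded (summ_sq x hx).1 fun m => ?_
  rw [norm_div, Real.norm_of_nonneg (sq_nonneg (x - (m:ℝ)))]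
  gcongr
  rw [Real.norm_eq_abs]
  rcases Int.sign_trichotomy m with h | h | h <;> rw [h] <;> simp

lemma int_split (f : ℤ → ℝ) (P N : ℝ) (h1 : HasSum (fun n : ℕ => f ((n : ℤ) + 1)) P)
    (h2 : HasSum (fun n : ℕ => f (-((n : ℤ) + 1))) N) : ∑' n : ℤ, f n = P + f 0 + N :=
  (HasSum.of_add_one_of_neg_add_one h1 h2).tsum_eq

lemma E_bound_pos (x : ℝ) (hx : ∀ n : ℤ, x ≠ n) (h0 : 0 < x) : |1 - H0 x| ≤ H1 x := by
  obtain ⟨hs, h1⟩ := summ_sq x hx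
  have hsg := summ_sign x hx
  have hsN : Summable (fun n : ℕ => 1 / (x + n + 1) ^ 2) := by
    have : Function.Injective (fun n : ℕ => (-((n:ℤ) + 1))) := fun a b h => by simp at h; exact h
    refine (hs.comp_injective this).congr fun n => ?_
    simp only [Function.comp]
    push_cast; congr 2; ring
  have hsP : Summable (fun n : ℕ => 1 / (x - (n + 1)) ^ 2) := by
    have : Function.Injective (fun n : ℕ => (((n:ℤ) + 1))) := fun a b h => by simp at h; exact h
    refine (hs.comp_injective this).congr fun n => ?_
    simp only [Function.comp]
    push_cast; rfl
  set N := ∑' n : ℕ, 1 / (x + n + 1) ^ 2 with hN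
  set P := ∑' n : ℕ, 1 / (x - (n + 1)) ^ 2 with hP
  have e1 : ∑' n : ℤ, 1 / (x - n) ^ 2 = P + 1 / x ^ 2 + N := by
    have a1 : HasSum (fun n : ℕ => (fun n : ℤ => 1 / (x - n) ^ 2) ((n : ℤ) + 1)) P := by
      have e : ∀ n : ℕ, (((n : ℤ) + 1 : ℤ) : ℝ) = n + 1 := fun n => by push_cast; ring
      simp only [e]
      exact hsP.hasSum
    have a2 : HasSum (fun n : ℕ => (fun n : ℤ => 1 / (x - n) ^ 2) (-((n : ℤ) + 1))) N := by
      have e : ∀ n : ℕ, x - ((-((n : ℤ) + 1) : ℤ) : ℝ) = x + n + 1 := fun n => by push_cast; ring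
      simp only [e]
      exact hsN.hasSum
    rw [int_split (fun n : ℤ => 1 / (x - n) ^ 2) P N a1 a2]
    simp
  have e2 : ∑' n : ℤ, (Int.sign n : ℝ) / (x - n) ^ 2 = P - N := by
    have a1 : HasSum (fun n : ℕ => (fun n : ℤ => (Int.sign n : ℝ) / (x - n) ^ 2) ((n : ℤ) + 1)) P := by
      have e : ∀ n : ℕ, (((n : ℤ) + 1 : ℤ) : ℝ) = n + 1 := fun n => by push_cast; ring
      have e' : ∀ n : ℕ, ((Int.sign ((n : ℤ) + 1) : ℤ) : ℝ) = 1 := fun n => by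
        rw [Int.sign_eq_one_of_pos (by positivity : (0:ℤ) < (n:ℤ) + 1)]; simp
      simp only [e, e']
      exact hsP.hasSum
    have a2 : HasSum (fun n : ℕ => (fun n : ℤ => (Int.sign n : ℝ) / (x - n) ^ 2) (-((n : ℤ) + 1))) (-N) := by
      have e : ∀ n : ℕ, x - ((-((n : ℤ) + 1) : ℤ) : ℝ) = x + n + 1 := fun n => by push_cast; ring
      have e' : ∀ n : ℕ, ((Int.sign (-((n : ℤ) + 1)) : ℤ) : ℝ) = -1 := fun n => by
        rw [Int.sign_neg, Int.sign_eq_one_of_pos (by positivity : (0:ℤ) < (n:ℤ) + 1)]; simp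
      simp only [e, e', neg_div]
      exact hsN.hasSum.neg
    rw [int_split (fun n : ℤ => (Int.sign n : ℝ) / (x - n) ^ 2) P (-N) a1 a2]
    simp [sub_eq_add_neg]
  have b1 : N ≤ 1 / x := by
    rw [← (tele x h0).tsum_eq]
    refine hsN.tsum_le_tsum (fun n => ?_) (tele x h0).summable
    have hn : (0:ℝ) ≤ n := Nat.cast_nonneg n
    have p1 : 0 < x + n := by positivity
    have p2 : 0 < x + n + 1 := by positivity
    rw [div_sub_div _ _ p1.ne' p2.ne', div_le_div_iff₀ (by positivity) (by positivity)]
    nlinarith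
  have b2 : 1 / (x + 1) ≤ N := by
    rw [← (tele (x + 1) (by positivity)).tsum_eq]
    refine (tele (x + 1) (by positivity)).summable.tsum_le_tsum (fun n => ?_) hsN
    have hn : (0:ℝ) ≤ n := Nat.cast_nonneg n
    have p1 : 0 < x + 1 + n := by positivity
    have p2 : 0 < x + 1 + n + 1 := by positivity
    rw [show x + n + 1 = x + 1 + n by ring]
    rw [div_sub_div _ _ p1.ne' p2.ne', div_le_div_iff₀ (by positivity) (by positivity)]
    nlinarith
  have b3 : 1 / x - 1 / x ^ 2 ≤ 1 / (x + 1) := by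
    rw [div_sub_div _ _ h0.ne' (by positivity), div_le_div_iff₀ (by positivity) (by positivity)]
    nlinarith [sq_nonneg x]
  rw [e1] at h1
  have key : 1 - H0 x = (Real.sin (π * x) / π) ^ 2 * (2 * N + 1 / x ^ 2 - 2 / x) := by
    unfold H0
    rw [e2]
    linear_combination (norm := ring_nf) -h1
  have h3 : H1 x = (Real.sin (π * x) / π) ^ 2 * (1 / x ^ 2) := by
    unfold H1
    have := Real.pi_ne_zero
    field_simp
  rw [key, h3, abs_mul, abs_of_nonneg (sq_nonneg _)]
  gcongr
  have t : 2 / x = 2 * (1 / x) := by ring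
  rw [abs_le]; constructor <;> linarith

noncomputable def EE (x : ℝ) : ℝ := (if 0 < x then 1 else -1) - H0 x

lemma EE_neg (x : ℝ) (hx : x ≠ 0) : EE (-x) = - EE x := by
  unfold EE
  rw [H0_neg]
  rcases lt_or_gt_of_ne hx with h | h
  · rw [if_pos (by linarith), if_neg (by linarith)]; ring
  · rw [if_neg (by linarith), if_pos (by linarith)]; ring

lemma EE_bound (x : ℝ) (hx : ∀ n : ℤ, x ≠ n) : |EE x| ≤ H1 x := by
  have hx0 : x ≠ 0 := by simpa using hx 0
  rcases lt_or_gt_of_ne hx0 with h | h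
  · have := E_bound_pos (-x) (fun n hn => hx (-n) (by push_cast; linarith)) (by linarith)
    rw [H1_neg] at this
    rw [← neg_neg x, EE_neg _ (by linarith), abs_neg]
    unfold EE
    rw [if_pos (by linarith)]
    simpa using this
  · unfold EE
    rw [if_pos h]
    exact E_bound_pos x hx h

lemma H0_meas : AEStronglyMeasurable H0 := by
  unfold H0
  have : AEStronglyMeasurable (fun x : ℝ => ∑' m : ℤ, (Int.sign m : ℝ) / (x - m) ^ 2) := by
    refine aestronglyMeasurable_of_tendsto_ae (u := (atTop : Filter (Finset ℤ)))
      (f := fun s x => ∑ m ∈ s, (Int.sign m : ℝ) / (x - m) ^ 2) (fun s => ?_) ?_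
    · exact (by fun_prop : Measurable _).aestronglyMeasurable
    · filter_upwards [ae_nonint] with x hx
      exact (summ_sign x hx).hasSum
  refine AEStronglyMeasurable.mul ?_ (this.add ?_)
  · exact (by fun_prop : Measurable _).aestronglyMeasurable
  · exact (by fun_prop : Measurable _).aestronglyMeasurable

lemma EE_int : Integrable EE := by
  refine Integrable.mono' H1_int ?_ ?_
  · unfold EE
    refine AEStronglyMeasurable.sub ?_ H0_meas
    exact (Measurable.ite measurableSet_Ioi measurable_const measurable_const).aestronglyMeasurable
  · filter_upwards [ae_nonint] with x hx using EE_bound x hx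

lemma EE_integral : ∫ x, EE x = 0 := by
  have h := integral_neg_eq_self EE volume
  have h2 : ∫ x, EE (-x) = ∫ x, - EE x := by
    refine integral_congr_ae ?_
    filter_upwards [ae_nonint] with x hx
    exact EE_neg x (by simpa using hx 0)
  rw [integral_neg] at h2
  linarith

lemma prod_bound (β x : ℝ) (hβ : 0 < β) :
    H1 (x + β) * H1 x ≤ 4 / (π ^ 2 * β ^ 2) * (H1 (x + β) + H1 x) := by
  have hp := Real.pi_pos
  have a := H1_nonneg x
  have b := H1_nonneg (x + β)
  have key : ∀ y : ℝ, β / 2 ≤ |y| → H1 y ≤ 4 / (π ^ 2 * β ^ 2) := by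
    intro y hy
    have h := H1_le y
    have h2 : (β / 2) ^ 2 ≤ y ^ 2 := by
      rw [← sq_abs y]; gcongr
    have h3 : (β / 2) ^ 2 * H1 y ≤ 1 / π ^ 2 :=
      le_trans (mul_le_mul_of_nonneg_right h2 (H1_nonneg y)) h
    rw [le_div_iff₀ (by positivity)] at h3 ⊢
    nlinarith
  have c : 0 ≤ 4 / (π ^ 2 * β ^ 2) := by positivity
  by_cases h : β / 2 ≤ |x|
  · nlinarith [key x h, mul_nonneg c a]
  · have : β / 2 ≤ |x + β| := by
      push Not at h
      have := abs_lt.1 h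
      rw [abs_of_pos] <;> linarith
    nlinarith [key _ this, mul_nonneg c b]

lemma G_lemma (G : ℝ → ℝ) (hG : Integrable G) (hb : ∀ᵐ x, |G x| ≤ 2 * H1 x) (β : ℝ) (hβ : 0 < β) :
    Integrable (fun x => G (x + β) * pairCorKernel x) ∧
    |(∫ x, G (x + β) * pairCorKernel x) - ∫ x, G x| ≤ 16 / (π ^ 2 * β ^ 2) := by
  have hGs := hG.comp_add_right β
  have hH := H1_int.comp_add_right β
  have hb' : ∀ᵐ x, |G (x + β)| ≤ 2 * H1 (x + β) :=
    (measurePreserving_add_right volume β).quasiMeasurePreserving.ae hb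
  have hd : ∀ᵐ x, ‖G (x + β) * H1 x‖ ≤ 8 / (π ^ 2 * β ^ 2) * (H1 (x + β) + H1 x) := by
    filter_upwards [hb'] with x hx
    have := prod_bound β x hβ
    rw [norm_mul, Real.norm_eq_abs, Real.norm_of_nonneg (H1_nonneg x)]
    have h2 := mul_le_mul_of_nonneg_right hx (H1_nonneg x)
    have e : 8 / (π ^ 2 * β ^ 2) = 2 * (4 / (π ^ 2 * β ^ 2)) := by ring
    rw [e]
    nlinarith
  have hdi : Integrable (fun x => 8 / (π ^ 2 * β ^ 2) * (H1 (x + β) + H1 x)) :=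
    (hH.add H1_int).const_mul _
  have hI : Integrable (fun x => G (x + β) * H1 x) :=
    hdi.mono' (hGs.aestronglyMeasurable.mul H1_meas.aestronglyMeasurable) hd
  have he : (fun x => G (x + β) * pairCorKernel x) = fun x => G (x + β) - G (x + β) * H1 x := by
    funext x; unfold pairCorKernel H1; ring
  rw [he]
  refine ⟨hGs.sub hI, ?_⟩
  rw [integral_sub hGs hI, integral_add_right_eq_self G β, sub_sub_cancel_left, abs_neg]
  have := norm_integral_le_of_norm_le hdi hd
  rw [integral_const_mul, integral_add hH H1_int, integral_add_right_eq_self H1 β, H1_integral] at this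
  rw [← Real.norm_eq_abs]
  refine this.trans (le_of_eq ?_)
  ring

lemma tail (β : ℝ) (hβ : 0 < β) :
    |(∫ x in Set.Ioi β, H1 x) - 1 / (2 * π ^ 2 * β)| ≤ 1 / β ^ 2 := by
  have hp := Real.pi_pos
  have hp3 := Real.pi_gt_three
  have hcube : IntegrableOn (fun x : ℝ => x ^ (-3 : ℝ)) (Set.Ioi β) :=
    integrableOn_Ioi_rpow_of_lt (by norm_num) hβ
  have hbd : ∀ x ∈ Set.Ioi β, ‖Real.sin (2 * π * x) / (2 * π ^ 3 * x ^ 3)‖ ≤ x ^ (-3 : ℝ) := by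
    intro x hx
    have hx0 : 0 < x := hβ.trans hx
    rw [show (-3 : ℝ) = -((3 : ℕ) : ℝ) by norm_num, Real.rpow_neg hx0.le, Real.rpow_natCast,
      norm_div, Real.norm_eq_abs, Real.norm_of_nonneg (by positivity), div_le_iff₀ (by positivity)]
    have : (x ^ 3)⁻¹ * (2 * π ^ 3 * x ^ 3) = 2 * π ^ 3 := by field_simp
    rw [this]
    have : 1 ≤ π ^ 3 := one_le_pow₀ (by linarith)
    linarith [Real.abs_sin_le_one (2 * π * x)]
  have hI : IntegrableOn (fun x : ℝ => Real.sin (2 * π * x) / (2 * π ^ 3 * x ^ 3)) (Set.Ioi β) := by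
    refine Integrable.mono' hcube ?_ ?_
    · exact (by fun_prop : Measurable _).aestronglyMeasurable
    · exact (ae_restrict_iff' measurableSet_Ioi).2 (ae_of_all _ hbd)
  have hF := integral_Ioi_of_hasDerivAt_of_tendsto' (a := β) (m := 0)
    (f := fun x : ℝ => -1 / (2 * π ^ 2 * x) - Real.sin (2 * π * x) / (4 * π ^ 3 * x ^ 2))
    (f' := fun x => H1 x + Real.sin (2 * π * x) / (2 * π ^ 3 * x ^ 3)) (by
      intro x hx
      have hx0 : x ≠ 0 := (hβ.trans_le hx).ne'
      have d1 : HasDerivAt (fun x : ℝ => -1 / (2 * π ^ 2 * x)) _ x :=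
        (hasDerivAt_const x (-1 : ℝ)).div ((hasDerivAt_id x).const_mul (2 * π ^ 2)) (by simp [hx0])
      have d2 : HasDerivAt (fun x : ℝ => Real.sin (2 * π * x) / (4 * π ^ 3 * x ^ 2)) _ x :=
        (((hasDerivAt_id x).const_mul (2 * π)).sin).div
          (((hasDerivAt_id x).pow 2).const_mul (4 * π ^ 3)) (by simp [hx0])
      refine (d1.sub d2).congr_deriv ?_
      unfold H1
      simp only [id]
      rw [show 2 * π * x = 2 * (π * x) by ring, Real.cos_two_mul, Real.cos_sq', Real.sin_two_mul]
      field_simp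
      simp
      ring) (H1_int.integrableOn.add hI) (by
      have t1 : Tendsto (fun x : ℝ => x⁻¹) atTop (nhds 0) := tendsto_inv_atTop_zero
      have t2 : Tendsto (fun x : ℝ => -1 / (2 * π ^ 2 * x)) atTop (nhds 0) := by
        have := t1.const_mul (-1 / (2 * π ^ 2))
        rw [mul_zero] at this
        refine this.congr fun x => ?_
        field_simp
      have t3 : Tendsto (fun x : ℝ => Real.sin (2 * π * x) / (4 * π ^ 3 * x ^ 2)) atTop (nhds 0) := by
        have h2 : Tendsto (fun x : ℝ => (x⁻¹) ^ 2) atTop (nhds 0) := by simpa using t1.pow 2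
        refine squeeze_zero_norm (fun x => ?_) h2
        rw [norm_div, Real.norm_eq_abs, Real.norm_of_nonneg (by positivity)]
        rcases eq_or_ne x 0 with rfl | hx
        · simp
        rw [div_le_iff₀ (by positivity)]
        have : (x⁻¹) ^ 2 * (4 * π ^ 3 * x ^ 2) = 4 * π ^ 3 := by field_simp
        rw [this]
        have : 1 ≤ π ^ 3 := one_le_pow₀ (by linarith)
        linarith [Real.abs_sin_le_one (2 * π * x)]
      simpa using t2.sub t3)
  rw [integral_add H1_int.integrableOn hI] at hF
  have hn : ‖∫ x in Set.Ioi β, Real.sin (2 * π * x) / (2 * π ^ 3 * x ^ 3)‖ ≤ 1 / (2 * β ^ 2) := by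
    refine (norm_integral_le_of_norm_le hcube
      ((ae_restrict_iff' measurableSet_Ioi).2 (ae_of_all _ hbd))).trans (le_of_eq ?_)
    rw [integral_Ioi_rpow_of_lt (by norm_num) hβ]
    rw [show (-3 + 1 : ℝ) = -((2 : ℕ) : ℝ) by norm_num, Real.rpow_neg hβ.le, Real.rpow_natCast]
    push_cast
    field_simp
  have hs : |Real.sin (2 * π * β) / (4 * π ^ 3 * β ^ 2)| ≤ 1 / (2 * β ^ 2) := by
    rw [abs_div, abs_of_pos (by positivity : 0 < 4 * π ^ 3 * β ^ 2),
      div_le_div_iff₀ (by positivity) (by positivity)]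
    have : 1 ≤ π ^ 3 := one_le_pow₀ (by linarith)
    nlinarith [Real.abs_sin_le_one (2 * π * β), sq_nonneg β, mul_le_mul_of_nonneg_right this (sq_nonneg β), mul_le_mul_of_nonneg_right (Real.abs_sin_le_one (2 * π * β)) (sq_nonneg β)]
  rw [Real.norm_eq_abs] at hn
  have e : (∫ x in Set.Ioi β, H1 x) - 1 / (2 * π ^ 2 * β) =
    Real.sin (2 * π * β) / (4 * π ^ 3 * β ^ 2) -
      ∫ x in Set.Ioi β, Real.sin (2 * π * x) / (2 * π ^ 3 * x ^ 3) := by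
    linear_combination (norm := ring_nf) hF
  rw [e]
  refine (abs_sub _ _).trans ((add_le_add hs hn).trans (le_of_eq ?_))
  ring

lemma chi_int (β : ℝ) (hβ : 0 < β) :
    IntegrableOn pairCorKernel (Set.Ioc (-β) β) ∧
    |(∫ x in Set.Ioc (-β) β, pairCorKernel x) - (2 * β - 1 + 1 / (π ^ 2 * β))| ≤ 2 / β ^ 2 := by
  have hk : pairCorKernel = fun x => 1 - H1 x := by
    funext x; rfl
  have h1 : IntegrableOn (fun _ : ℝ => (1:ℝ)) (Set.Ioc (-β) β) := by simp
  have h2 : IntegrableOn H1 (Set.Ioc (-β) β) := H1_int.integrableOn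
  rw [hk]
  refine ⟨h1.sub h2, ?_⟩
  rw [integral_sub h1 h2]
  have e1 := integral_comp_neg_Ioi β H1
  simp_rw [H1_neg] at e1
  have e2 : (∫ x in Set.Iic (-β), H1 x) + ∫ x in Set.Ioi (-β), H1 x = ∫ x, H1 x :=
    intervalIntegral.integral_Iic_add_Ioi H1_int.integrableOn H1_int.integrableOn
  have e3 : (∫ x in Set.Ioc (-β) β, H1 x) + ∫ x in Set.Ioi β, H1 x = ∫ x in Set.Ioi (-β), H1 x := by
    rw [← setIntegral_union (Set.Ioc_disjoint_Ioi le_rfl) measurableSet_Ioi h2 H1_int.integrableOn,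
      Set.Ioc_union_Ioi_eq_Ioi (by linarith)]
  rw [H1_integral] at e2
  have e4 : ∫ x in Set.Ioc (-β) β, (1:ℝ) = 2 * β := by
    simp; rw [max_eq_left (by linarith)]; ring
  have t := tail β hβ
  have e5 : (∫ x in Set.Ioc (-β) β, (1:ℝ)) - (∫ x in Set.Ioc (-β) β, H1 x) - (2 * β - 1 + 1 / (π ^ 2 * β))
      = 2 * ((∫ x in Set.Ioi β, H1 x) - 1 / (2 * π ^ 2 * β)) := by
    rw [e4]
    linear_combination (norm := ring_nf) -e3 - e2 - e1
  rw [e5, abs_mul, abs_two]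
  calc _ ≤ 2 * (1 / β ^ 2) := by gcongr
    _ = _ := by ring

lemma core (s : ℝ) (hs : |s| = 1) (β : ℝ) (hβ : 0 < β) (R : ℝ → ℝ)
    (hR : ∀ x, R x = (H0 (x + β) + s * H1 (x + β) + (H0 (-x + β) + s * H1 (-x + β))) / 2) :
    |(1 / 2) * Mpc R - (β - 1 / 2 + s / 2 + 1 / (2 * π ^ 2 * β))| ≤ 9 / β ^ 2 := by
  have hp3 := Real.pi_gt_three
  set G : ℝ → ℝ := fun x => EE x - s * H1 x with hGdef
  have hG : Integrable G := EE_int.sub (H1_int.const_mul s)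
  have hGi : ∫ x, G x = - s := by
    rw [hGdef, integral_sub EE_int (H1_int.const_mul s), EE_integral, integral_const_mul, H1_integral]
    ring
  have hb : ∀ᵐ x, |G x| ≤ 2 * H1 x := by
    filter_upwards [ae_nonint] with x hx
    refine (abs_sub _ _).trans ?_
    rw [abs_mul, hs, abs_of_nonneg (H1_nonneg x)]
    linarith [EE_bound x hx]
  obtain ⟨g1, g2⟩ := G_lemma G hG hb β hβ
  obtain ⟨c1, c2⟩ := chi_int β hβ
  have hkn : ∀ x, pairCorKernel (-x) = pairCorKernel x := fun x => by
    show 1 - H1 (-x) = 1 - H1 x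
    rw [H1_neg]
  have g1' : Integrable (fun x => G (-x + β) * pairCorKernel x) := by
    have := g1.comp_neg
    simpa only [hkn] using this
  have g3 : ∫ x, G (-x + β) * pairCorKernel x = ∫ x, G (x + β) * pairCorKernel x := by
    rw [← integral_neg_eq_self (fun x => G (x + β) * pairCorKernel x) volume]
    simp only [hkn]
  have hM : Mpc R = (∫ x in Set.Ioc (-β) β, pairCorKernel x) - ∫ x, G (x + β) * pairCorKernel x := by
    have c3 : Integrable ((Set.Ioc (-β) β).indicator pairCorKernel) :=
      (integrable_indicator_iff measurableSet_Ioc).2 c1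
    have c4 : Integrable (fun x => (1/2) * (G (x + β) * pairCorKernel x) +
        (1/2) * (G (-x + β) * pairCorKernel x)) := (g1.const_mul _).add (g1'.const_mul _)
    have : Mpc R = ∫ x, ((Set.Ioc (-β) β).indicator pairCorKernel x
        - ((1/2) * (G (x + β) * pairCorKernel x) + (1/2) * (G (-x + β) * pairCorKernel x))) := by
      unfold Mpc
      refine integral_congr_ae ?_
      have n1 : ∀ᵐ x : ℝ, x ≠ β := by
        rw [ae_iff]; simp
      have n2 : ∀ᵐ x : ℝ, x ≠ -β := by
        rw [ae_iff]; simp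
      filter_upwards [n1, n2] with x hx1 hx2
      simp only [hR, hGdef, EE]
      by_cases h1 : -β < x
      · by_cases h2 : x < β
        · rw [Set.indicator_of_mem (show x ∈ Set.Ioc (-β) β from ⟨h1, h2.le⟩),
            if_pos (by linarith), if_pos (by linarith)]
          ring
        · rw [Set.indicator_of_notMem (fun h => hx1 (le_antisymm h.2 (not_lt.1 h2))),
            if_pos (by linarith), if_neg (by linarith)]
          ring
      · rw [Set.indicator_of_notMem (fun h => h1 h.1),
            if_neg (by linarith), if_pos (by linarith)]
        ring
    rw [this, integral_sub c3 c4,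
      integral_add (g1.const_mul _) (g1'.const_mul _), integral_const_mul, integral_const_mul, g3,
      integral_indicator measurableSet_Ioc]
    ring
  rw [hGi] at g2
  have e : (1 / 2) * Mpc R - (β - 1 / 2 + s / 2 + 1 / (2 * π ^ 2 * β)) =
    (1/2) * (((∫ x in Set.Ioc (-β) β, pairCorKernel x) - (2 * β - 1 + 1 / (π ^ 2 * β)))
      - ((∫ x, G (x + β) * pairCorKernel x) - -s)) := by
    rw [hM]
    ring
  have hle : 16 / (π ^ 2 * β ^ 2) ≤ 16 / β ^ 2 := by
    gcongr
    nlinarith [sq_nonneg β, mul_le_mul_of_nonneg_right (by nlinarith : 1 ≤ π ^ 2) (sq_nonneg β)]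
  rw [e, abs_mul, abs_of_pos (by norm_num : (0:ℝ) < 1/2)]
  calc _ ≤ (1/2) * (2 / β ^ 2 + 16 / β ^ 2) := by
        gcongr
        exact (abs_sub _ _).trans (add_le_add c2 (g2.trans hle))
    _ = _ := by ring

theorem M_of_beurling_selberg_asymptotic :
    ∃ C > 0, ∃ β₀ > 0, ∀ β ≥ β₀,
      |(1 / 2) * Mpc (rPlus β) - (β - 1 / 2 + 1 / 2 + 1 / (2 * π ^ 2 * β))| ≤ C / β ^ 2 ∧
      |(1 / 2) * Mpc (rMinus β) - (β - 1 / 2 - 1 / 2 + 1 / (2 * π ^ 2 * β))| ≤ C / β ^ 2 := by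
  refine ⟨9, by norm_num, 1, by norm_num, fun β hβ => ⟨?_, ?_⟩⟩
  · have h := core 1 (by simp) β (by linarith) (rPlus β) (fun x => by
      unfold rPlus Hplus; ring)
    exact h
  · have h := core (-1) (by simp) β (by linarith) (rMinus β) (fun x => by
      unfold rMinus Hminus; ring)
    rw [neg_div, ← sub_eq_add_neg] at h
    exact h
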